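/- arXiv:1406.0411 — 2 statements merged into one kernel-verified Lean document; each statement's English description precedes it below -/
import Mathlib

section
/- Let φ : ℝ^d → ℝ be a smooth function with φ ≥ 0, support contained in [0,1]^d, and ∫_{ℝ^d} φ(t) dt = 1. Let ε > 0 and μ ∈ ℕ, and define K : ℝ^d × ℝ^d → ℝ by K(t,x) = ε^{-d} ⟨x⟩^{μd} φ(ε^{-1} ⟨x⟩^{μ} (t − x)). Then K is a slowly increasing function on ℝ^d × ℝ^d = ℝ^{2d}: K is infinitely differentiable and for every multi-index α ∈ ℕ₀^{2d} there exists N ∈ ℕ such that sup_{(t,x)∈ℝ^{2d}} ⟨(t,x)⟩^{-N} |∂^α K(t,x)| < ∞. -/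
open MeasureTheory Set

/-- A function supported in the unit cube of `ℝ^d` has compact support. -/
theorem hasCompactSupport_of_support_subset_unitCube {d : ℕ} {φ : EuclideanSpace ℝ (Fin d) → ℝ}
    (hφ : Function.support φ ⊆ {t | ∀ j : Fin d, t j ∈ Icc (0 : ℝ) 1}) :
    HasCompactSupport φ := by
  refine HasCompactSupport.of_support_subset_isCompact
    (K := (EuclideanSpace.equiv (Fin d) ℝ) ⁻¹' (univ.pi fun _ => Icc (0 : ℝ) 1)) ?_
    fun t ht j _ => hφ ht j
  exact (EuclideanSpace.equiv (Fin d) ℝ).toHomeomorph.isCompact_preimage.2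
    (isCompact_univ_pi fun _ => isCompact_Icc)

/-- The derivatives of a function of temperate growth are bounded by powers of `1 + ‖x‖ ^ 2`. -/
theorem Function.HasTemperateGrowth.norm_iteratedFDeriv_le_one_add_sq {E F : Type*}
    [NormedAddCommGroup E] [NormedSpace ℝ E] [NormedAddCommGroup F] [NormedSpace ℝ F]
    {f : E → F} (hf : f.HasTemperateGrowth) (n : ℕ) :
    ∃ (N : ℕ) (C : ℝ), ∀ x, ‖iteratedFDeriv ℝ n f x‖ ≤ C * (1 + ‖x‖ ^ 2) ^ N := by
  obtain ⟨N, C, hC, h⟩ := hf.norm_iteratedFDeriv_le_uniform n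
  refine ⟨N, C * 2 ^ N, fun x => (h n le_rfl x).trans ?_⟩
  rw [mul_assoc, ← mul_pow]
  gcongr
  nlinarith [sq_nonneg (‖x‖ - 1), sq_nonneg ‖x‖]

/-- With `φ`, `ε`, `μ`, `K` as in Statement 4, the kernel `K` is a slowly
increasing function on `ℝ^d × ℝ^d = ℝ^{2d}`: it is infinitely differentiable and each of
its iterated derivatives is bounded by a constant times a power of `⟨(t,x)⟩ = 1 + ‖(t,x)‖²`. -/
theorem stmt5 (d : ℕ) (φ : EuclideanSpace ℝ (Fin d) → ℝ)
    (hφ_smooth : ContDiff ℝ (⊤ : ℕ∞) φ)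
    (hφ_nonneg : ∀ t, 0 ≤ φ t)
    (hφ_supp : Function.support φ ⊆ {t | ∀ j : Fin d, t j ∈ Icc (0 : ℝ) 1})
    (hφ_int : ∫ t, φ t = 1)
    (ε : ℝ) (hε : 0 < ε) (μ : ℕ)
    (K : EuclideanSpace ℝ (Fin d) × EuclideanSpace ℝ (Fin d) → ℝ)
    (hK : ∀ p, K p =
      (ε ^ d)⁻¹ * (1 + ‖p.2‖ ^ 2) ^ (μ * d) * φ ((ε⁻¹ * (1 + ‖p.2‖ ^ 2) ^ μ) • (p.1 - p.2))) :
    ContDiff ℝ (⊤ : ℕ∞) K ∧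
    ∀ k : ℕ, ∃ (N : ℕ) (C : ℝ), ∀ p,
      ‖iteratedFDeriv ℝ k K p‖ ≤ C * (1 + ‖p‖ ^ 2) ^ N := by
  have hφ : φ.HasTemperateGrowth :=
    (hasCompactSupport_of_support_subset_unitCube hφ_supp).hasTemperateGrowth hφ_smooth
  have h₁ : (fun p : EuclideanSpace ℝ (Fin d) × EuclideanSpace ℝ (Fin d) =>
      p.1).HasTemperateGrowth := (ContinuousLinearMap.fst ℝ (EuclideanSpace ℝ (Fin d))
      (EuclideanSpace ℝ (Fin d))).hasTemperateGrowth
  have h₂ : (fun p : EuclideanSpace ℝ (Fin d) × EuclideanSpace ℝ (Fin d) =>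
      p.2).HasTemperateGrowth := (ContinuousLinearMap.snd ℝ (EuclideanSpace ℝ (Fin d))
      (EuclideanSpace ℝ (Fin d))).hasTemperateGrowth
  have hw : (fun p : EuclideanSpace ℝ (Fin d) × EuclideanSpace ℝ (Fin d) =>
      1 + ‖p.2‖ ^ 2).HasTemperateGrowth :=
    (Function.HasTemperateGrowth.const 1).add
      ((Function.hasTemperateGrowth_norm_sq (EuclideanSpace ℝ (Fin d))).comp h₂)
  have hK' : K.HasTemperateGrowth := by
    rw [funext hK]
    exact ((Function.HasTemperateGrowth.const _).mul (hw.pow _)).mul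
      (hφ.comp (((Function.HasTemperateGrowth.const _).mul (hw.pow _)).smul (h₁.sub h₂)))
  exact ⟨hK'.1, hK'.norm_iteratedFDeriv_le_one_add_sq⟩
end

section
/- Let n ∈ ℕ and let f : ℝ² → ℂ be a 2n-times continuously differentiable function. Denote by T_1 and T_2 the operators of integration from 0 in the first and second variable, i.e., (T_1 h)(x_1,x_2) = ∫_0^{x_1} h(t,x_2) dt and (T_2 h)(x_1,x_2) = ∫_0^{x_2} h(x_1,t) dt. Then for all x = (x_1,x_2) ∈ ℝ²: (T_1^n T_2^n ∂^{(n,n)} f)(x) = f(x) + Σ_{α_1<n, α_2<n} ∂^α f(0,0) x^α/α! − Σ_{j=0}^{n−1} ∂^{(j,0)} f(0,x_2) x_1^j/j! − Σ_{j=0}^{n−1} ∂^{(0,j)} f(x_1,0) x_2^j/j!, where for a multi-index α = (α_1,α_2), x^α = x_1^{α_1} x_2^{α_2}, α! = α_1! α_2!, and ∂^α denotes the corresponding mixed partial derivative. -/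
open MeasureTheory

/-- Partial derivative in the first variable of a function `ℝ → ℝ → ℂ`. -/
noncomputable def pd1 (f : ℝ → ℝ → ℂ) : ℝ → ℝ → ℂ :=
  fun x y => deriv (fun s => f s y) x

/-- Partial derivative in the second variable of a function `ℝ → ℝ → ℂ`. -/
noncomputable def pd2 (f : ℝ → ℝ → ℂ) : ℝ → ℝ → ℂ :=
  fun x y => deriv (fun s => f x s) y

/-- Mixed partial derivative `∂^{(j,k)}` of order `j` in the first variable and `k`
in the second variable. -/
noncomputable def pdMixed (j k : ℕ) (f : ℝ → ℝ → ℂ) : ℝ → ℝ → ℂ :=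
  pd1^[j] (pd2^[k] f)

/-- Integration from `0` in the first variable: `(T₁ h)(x₁,x₂) = ∫_0^{x₁} h(t,x₂) dt`. -/
noncomputable def T1 (h : ℝ → ℝ → ℂ) : ℝ → ℝ → ℂ :=
  fun x y => ∫ t in (0 : ℝ)..x, h t y

/-- Integration from `0` in the second variable: `(T₂ h)(x₁,x₂) = ∫_0^{x₂} h(x₁,t) dt`. -/
noncomputable def T2 (h : ℝ → ℝ → ℂ) : ℝ → ℝ → ℂ :=
  fun x y => ∫ t in (0 : ℝ)..y, h x t

/-- Integration from `0` of a function of one real variable. -/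
noncomputable def integralFromZero (g : ℝ → ℂ) : ℝ → ℂ :=
  fun x => ∫ t in (0 : ℝ)..x, g t

theorem continuous_integralFromZero {g : ℝ → ℂ} (hg : Continuous g) :
    Continuous (integralFromZero g) :=
  intervalIntegral.continuous_primitive (fun a b => hg.intervalIntegrable a b) 0

theorem T1_iterate_apply (n : ℕ) (h : ℝ → ℝ → ℂ) (x y : ℝ) :
    T1^[n] h x y = integralFromZero^[n] (fun s => h s y) x := by
  induction n generalizing h with
  | zero => rfl
  | succ n ih => simp only [Function.iterate_succ_apply, ih]; rfl

theorem T2_iterate_apply (n : ℕ) (h : ℝ → ℝ → ℂ) (x y : ℝ) :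
    T2^[n] h x y = integralFromZero^[n] (h x) y := by
  induction n generalizing h with
  | zero => rfl
  | succ n ih => simp only [Function.iterate_succ_apply, ih]; rfl

theorem pd1_iterate_apply (n : ℕ) (f : ℝ → ℝ → ℂ) (x y : ℝ) :
    pd1^[n] f x y = deriv^[n] (fun s => f s y) x := by
  induction n generalizing f with
  | zero => rfl
  | succ n ih => simp only [Function.iterate_succ_apply, ih]; rfl

theorem pd2_iterate_apply (n : ℕ) (f : ℝ → ℝ → ℂ) (x y : ℝ) :
    pd2^[n] f x y = deriv^[n] (f x) y := by
  induction n generalizing f with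
  | zero => rfl
  | succ n ih => simp only [Function.iterate_succ_apply, ih]; rfl

theorem integralFromZero_iterate_sub_sum {ι : Type*} (s : Finset ι) (n : ℕ) (u : ℝ → ℂ)
    (v : ι → ℝ → ℂ) (c : ι → ℂ) (hu : Continuous u) (hv : ∀ j ∈ s, Continuous (v j)) (x : ℝ) :
    integralFromZero^[n] (fun t => u t - ∑ j ∈ s, v j t * c j) x =
      integralFromZero^[n] u x - ∑ j ∈ s, integralFromZero^[n] (v j) x * c j := by
  induction n generalizing u v with
  | zero => rfl
  | succ n ih =>
    simp only [Function.iterate_succ_apply]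
    rw [← ih _ _ (continuous_integralFromZero hu) fun j hj => continuous_integralFromZero (hv j hj)]
    refine congrFun (congrArg _ (funext fun y => ?_)) x
    have hc : ∀ j ∈ s, Continuous fun t => v j t * c j := fun j hj =>
      (hv j hj).mul continuous_const
    simp only [integralFromZero]
    rw [intervalIntegral.integral_sub (hu.intervalIntegrable _ _)
      ((continuous_finsetSum s hc).intervalIntegrable _ _),
      intervalIntegral.integral_finsetSum fun j hj => (hc j hj).intervalIntegrable _ _]
    simp only [intervalIntegral.integral_mul_const]

/-- Taylor's formula at `0` with the remainder written as an iterated integral. -/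
theorem integralFromZero_iterate_deriv (n : ℕ) (g : ℝ → ℂ) (hg : ContDiff ℝ n g) (x : ℝ) :
    integralFromZero^[n] (deriv^[n] g) x =
      g x - ∑ j ∈ Finset.range n, deriv^[j] g 0 * x ^ j / (j.factorial : ℂ) := by
  induction n generalizing g x with
  | zero => simp
  | succ n ih =>
    have hg' : ContDiff ℝ (n + 1) g := by exact_mod_cast hg
    obtain ⟨hd, -, hdg⟩ := contDiff_succ_iff_deriv.1 hg'
    rw [Function.iterate_succ_apply', Function.iterate_succ_apply,
      funext (ih (deriv g) hdg), Finset.sum_range_succ']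
    have hderiv : ∀ t ∈ Set.uIcc (0 : ℝ) x, HasDerivAt
        (fun t : ℝ => g t - ∑ j ∈ Finset.range n,
          deriv^[j + 1] g 0 * (t : ℂ) ^ (j + 1) / ((j + 1).factorial : ℂ))
        (deriv g t - ∑ j ∈ Finset.range n,
          deriv^[j] (deriv g) 0 * (t : ℂ) ^ j / (j.factorial : ℂ)) t := by
      intro t _
      refine (hd t).hasDerivAt.sub (HasDerivAt.fun_sum fun j _ => ?_)
      have hp := (((hasDerivAt_id t).ofReal_comp.pow (j + 1)).const_mul
        (deriv^[j + 1] g 0)).div_const ((j + 1).factorial : ℂ)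
      refine hp.congr_deriv ?_
      have h1 : (j.factorial : ℂ) ≠ 0 := by exact_mod_cast j.factorial_ne_zero
      have h2 : (j + 1 : ℂ) ≠ 0 := by exact_mod_cast j.succ_ne_zero
      simp only [Nat.factorial_succ, Function.iterate_succ_apply]
      push_cast
      simp
      field_simp
    have hcont : Continuous fun t : ℝ => deriv g t - ∑ j ∈ Finset.range n,
        deriv^[j] (deriv g) 0 * (t : ℂ) ^ j / (j.factorial : ℂ) := by
      have := hdg.continuous
      fun_prop
    rw [integralFromZero, intervalIntegral.integral_eq_sub_of_hasDerivAt hderiv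
      (hcont.intervalIntegrable _ _)]
    simp
    ring

theorem pd1_eq_fderiv {f : ℝ → ℝ → ℂ} (hf : Differentiable ℝ fun p : ℝ × ℝ => f p.1 p.2)
    (x y : ℝ) : pd1 f x y = fderiv ℝ (fun p : ℝ × ℝ => f p.1 p.2) (x, y) (1, 0) :=
  (HasFDerivAt.comp_hasDerivAt (f := fun s : ℝ => (s, y)) x (hf (x, y)).hasFDerivAt
    ((hasDerivAt_id x).prodMk (hasDerivAt_const x y))).deriv

theorem pd2_eq_fderiv {f : ℝ → ℝ → ℂ} (hf : Differentiable ℝ fun p : ℝ × ℝ => f p.1 p.2)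
    (x y : ℝ) : pd2 f x y = fderiv ℝ (fun p : ℝ × ℝ => f p.1 p.2) (x, y) (0, 1) :=
  (HasFDerivAt.comp_hasDerivAt (f := fun s : ℝ => (x, s)) y (hf (x, y)).hasFDerivAt
    ((hasDerivAt_const y x).prodMk (hasDerivAt_id y))).deriv

theorem contDiff_pd1 {m : ℕ} {f : ℝ → ℝ → ℂ}
    (hf : ContDiff ℝ (m + 1 : ℕ) fun p : ℝ × ℝ => f p.1 p.2) :
    ContDiff ℝ m fun p : ℝ × ℝ => pd1 f p.1 p.2 := by
  simp only [pd1_eq_fderiv (hf.differentiable (by simp))]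
  exact (hf.fderiv_right (by norm_cast)).clm_apply contDiff_const

theorem contDiff_pd2 {m : ℕ} {f : ℝ → ℝ → ℂ}
    (hf : ContDiff ℝ (m + 1 : ℕ) fun p : ℝ × ℝ => f p.1 p.2) :
    ContDiff ℝ m fun p : ℝ × ℝ => pd2 f p.1 p.2 := by
  simp only [pd2_eq_fderiv (hf.differentiable (by simp))]
  exact (hf.fderiv_right (by norm_cast)).clm_apply contDiff_const

theorem contDiff_pd1_iterate {m : ℕ} (j : ℕ) {f : ℝ → ℝ → ℂ}
    (hf : ContDiff ℝ (m + j : ℕ) fun p : ℝ × ℝ => f p.1 p.2) :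
    ContDiff ℝ m fun p : ℝ × ℝ => pd1^[j] f p.1 p.2 := by
  induction j generalizing f with
  | zero => exact hf
  | succ j ih => exact ih (contDiff_pd1 hf)

theorem contDiff_pd2_iterate {m : ℕ} (k : ℕ) {f : ℝ → ℝ → ℂ}
    (hf : ContDiff ℝ (m + k : ℕ) fun p : ℝ × ℝ => f p.1 p.2) :
    ContDiff ℝ m fun p : ℝ × ℝ => pd2^[k] f p.1 p.2 := by
  induction k generalizing f with
  | zero => exact hf
  | succ k ih => exact ih (contDiff_pd2 hf)

theorem pd1_pd2_comm {f : ℝ → ℝ → ℂ} (hf : ContDiff ℝ 2 fun p : ℝ × ℝ => f p.1 p.2) :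
    pd1 (pd2 f) = pd2 (pd1 f) := by
  have hd : Differentiable ℝ fun p : ℝ × ℝ => f p.1 p.2 := hf.differentiable (by simp)
  have hd1 := (contDiff_pd1 (m := 1) hf).differentiable (by simp)
  have hd2 := (contDiff_pd2 (m := 1) hf).differentiable (by simp)
  have hdd : Differentiable ℝ (fderiv ℝ fun p : ℝ × ℝ => f p.1 p.2) :=
    (hf.fderiv_right (m := 1) (by norm_num)).differentiable (by simp)
  funext x y
  rw [pd1_eq_fderiv hd2, pd2_eq_fderiv hd1]
  simp only [pd1_eq_fderiv hd, pd2_eq_fderiv hd, Prod.mk.eta]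
  rw [fderiv_clm_apply (hdd _) (differentiableAt_const _),
    fderiv_clm_apply (hdd _) (differentiableAt_const _)]
  simpa using (hf.contDiffAt (x := (x, y))).isSymmSndFDerivAt (by simp) (1, 0) (0, 1)

theorem pd1_pd2_iterate_comm (k : ℕ) {f : ℝ → ℝ → ℂ}
    (hf : ContDiff ℝ (k + 1 : ℕ) fun p : ℝ × ℝ => f p.1 p.2) :
    pd1 (pd2^[k] f) = pd2^[k] (pd1 f) := by
  induction k generalizing f with
  | zero => rfl
  | succ k ih =>
    rw [Function.iterate_succ_apply, Function.iterate_succ_apply, ih (contDiff_pd2 hf),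
      pd1_pd2_comm (hf.of_le (by norm_cast; omega))]

theorem pd1_iterate_pd2_iterate_comm (j k : ℕ) {f : ℝ → ℝ → ℂ}
    (hf : ContDiff ℝ (k + j : ℕ) fun p : ℝ × ℝ => f p.1 p.2) :
    pd1^[j] (pd2^[k] f) = pd2^[k] (pd1^[j] f) := by
  induction j generalizing f with
  | zero => rfl
  | succ j ih =>
    rw [Function.iterate_succ_apply, Function.iterate_succ_apply,
      pd1_pd2_iterate_comm k (hf.of_le (by norm_cast; omega)), ih (contDiff_pd1 hf)]

/-- for a `2n`-times continuously differentiable `f : ℝ² → ℂ`,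
`(T₁ⁿ T₂ⁿ ∂^{(n,n)} f)(x) = f(x) + Σ_{α₁,α₂<n} ∂^α f(0,0) x^α/α!
  − Σ_{j<n} ∂^{(j,0)} f(0,x₂) x₁^j/j! − Σ_{j<n} ∂^{(0,j)} f(x₁,0) x₂^j/j!`. -/
theorem stmt11 (n : ℕ) (f : ℝ → ℝ → ℂ)
    (hf : ContDiff ℝ ((2 * n : ℕ) : ℕ∞) (fun p : ℝ × ℝ => f p.1 p.2)) :
    ∀ x₁ x₂ : ℝ,
      T1^[n] (T2^[n] (pdMixed n n f)) x₁ x₂ =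
        f x₁ x₂
        + ∑ a₁ ∈ Finset.range n, ∑ a₂ ∈ Finset.range n,
            pdMixed a₁ a₂ f 0 0 * x₁ ^ a₁ * x₂ ^ a₂ /
              ((a₁.factorial : ℂ) * (a₂.factorial : ℂ))
        - ∑ j ∈ Finset.range n, pdMixed j 0 f 0 x₂ * x₁ ^ j / (j.factorial : ℂ)
        - ∑ j ∈ Finset.range n, pdMixed 0 j f x₁ 0 * x₂ ^ j / (j.factorial : ℂ) := by
  intro x₁ x₂
  have hf' : ∀ m : ℕ, m ≤ 2 * n → ContDiff ℝ m fun p : ℝ × ℝ => f p.1 p.2 := fun m hm =>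
    hf.of_le (by exact_mod_cast hm)
  have hn : ContDiff ℝ n fun p : ℝ × ℝ => pd1^[n] f p.1 p.2 :=
    contDiff_pd1_iterate n (hf' _ (by omega))
  have hinner : ∀ s, T2^[n] (pdMixed n n f) s x₂ = pd1^[n] f s x₂ - ∑ j ∈ Finset.range n,
      pd1^[n] (pd2^[j] f) s 0 * (x₂ ^ j / (j.factorial : ℂ)) := by
    intro s
    rw [pdMixed, pd1_iterate_pd2_iterate_comm n n (hf' _ (by omega)), T2_iterate_apply,
      funext (pd2_iterate_apply n (pd1^[n] f) s), integralFromZero_iterate_deriv n (pd1^[n] f s)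
        (hn.comp (contDiff_const.prodMk contDiff_id))]
    refine congrArg _ (Finset.sum_congr rfl fun j hj => ?_)
    have hj := Finset.mem_range.1 hj
    rw [pd1_iterate_pd2_iterate_comm n j (hf' _ (by omega)), pd2_iterate_apply, mul_div_assoc]
  have hC : ∀ j < n, ContDiff ℝ n fun p : ℝ × ℝ => pd2^[j] f p.1 p.2 := fun j hj =>
    contDiff_pd2_iterate j (hf' _ (by omega))
  have hcont : ∀ j < n, Continuous fun s => pd1^[n] (pd2^[j] f) s 0 := fun j hj =>
    (contDiff_pd1_iterate (m := 0) n (by simpa using hC j hj)).continuous.comp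
      (Continuous.prodMk_left 0)
  have htaylor : ∀ (g : ℝ → ℝ → ℂ), (ContDiff ℝ n fun p : ℝ × ℝ => g p.1 p.2) → ∀ y,
      integralFromZero^[n] (fun s => pd1^[n] g s y) x₁ =
        g x₁ y - ∑ i ∈ Finset.range n, pd1^[i] g 0 y * x₁ ^ i / (i.factorial : ℂ) := by
    intro g hg y
    rw [funext fun s => pd1_iterate_apply n g s y, integralFromZero_iterate_deriv n (fun s => g s y)
      (hg.comp (contDiff_id.prodMk contDiff_const))]
    simp only [pd1_iterate_apply]
  have hsum : ∑ j ∈ Finset.range n, integralFromZero^[n] (fun s => pd1^[n] (pd2^[j] f) s 0) x₁ *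
        (x₂ ^ j / (j.factorial : ℂ)) =
      ∑ j ∈ Finset.range n, pdMixed 0 j f x₁ 0 * x₂ ^ j / (j.factorial : ℂ) -
        ∑ a₁ ∈ Finset.range n, ∑ a₂ ∈ Finset.range n,
          pdMixed a₁ a₂ f 0 0 * x₁ ^ a₁ * x₂ ^ a₂ /
            ((a₁.factorial : ℂ) * (a₂.factorial : ℂ)) := by
    rw [Finset.sum_comm, ← Finset.sum_sub_distrib]
    refine Finset.sum_congr rfl fun j hj => ?_
    rw [htaylor _ (hC j (Finset.mem_range.1 hj)), sub_mul, Finset.sum_mul, ← mul_div_assoc]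
    refine congrArg _ (Finset.sum_congr rfl fun i _ => ?_)
    rw [div_mul_div_comm, pdMixed]
  rw [T1_iterate_apply, funext hinner, integralFromZero_iterate_sub_sum _ _
    (fun s => pd1^[n] f s x₂) (fun j s => pd1^[n] (pd2^[j] f) s 0) _
    (hn.continuous.comp (Continuous.prodMk_left x₂))
    (fun j hj => hcont j (Finset.mem_range.1 hj)), htaylor f (hf' _ (by omega)), hsum]
  simp only [pdMixed, Function.iterate_zero, id]
  ring
end
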